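/- Let μ > 0, γ > 0 with γ ≥ √μ/2, and let x ∈ ℝ. Then the function J : ℝ → ℝ defined by J(u) = (x − u)²/(2μ) + log((γ² + u²)/γ) attains a global minimum at exactly one point of ℝ, i.e. there exists a unique u* ∈ ℝ with J(u*) ≤ J(u) for all u ∈ ℝ. -/

import Mathlib

/-- The derivative of the Cauchy proximal cost is strictly increasing when `μ ≤ 4 γ ^ 2`. -/
theorem strictMono_cauchy_prox_deriv {μ γ : ℝ} (hμ : 0 < μ) (hγ : 0 < γ) (h : μ ≤ 4 * γ ^ 2)
    (x : ℝ) : StrictMono fun u : ℝ => (u - x) / μ + 2 * u / (γ ^ 2 + u ^ 2) := by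
  intro a b hab
  have ha : 0 < γ ^ 2 + a ^ 2 := by positivity
  have hb : 0 < γ ^ 2 + b ^ 2 := by positivity
  have hsub : 0 < b - a := sub_pos.2 hab
  have key : 0 < (b - a) / (4 * γ ^ 2) + (2 * b / (γ ^ 2 + b ^ 2) - 2 * a / (γ ^ 2 + a ^ 2)) := by
    have e : (b - a) / (4 * γ ^ 2) + (2 * b / (γ ^ 2 + b ^ 2) - 2 * a / (γ ^ 2 + a ^ 2)) =
        (b - a) * ((a * b - 3 * γ ^ 2) ^ 2 + γ ^ 2 * (b - a) ^ 2) /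
          (4 * γ ^ 2 * ((γ ^ 2 + a ^ 2) * (γ ^ 2 + b ^ 2))) := by
      field_simp
      ring
    rw [e]
    positivity
  have hle : (b - a) / (4 * γ ^ 2) ≤ (b - a) / μ := by gcongr
  have e : (b - x) / μ - (a - x) / μ = (b - a) / μ := by ring
  dsimp only
  linarith

theorem hasDerivAt_cauchy_prox_cost (μ : ℝ) {γ : ℝ} (hγ : 0 < γ) (x u : ℝ) :
    HasDerivAt (fun u : ℝ => (x - u) ^ 2 / (2 * μ) + Real.log ((γ ^ 2 + u ^ 2) / γ))
      ((u - x) / μ + 2 * u / (γ ^ 2 + u ^ 2)) u := by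
  have hu : 0 < γ ^ 2 + u ^ 2 := by positivity
  have hquad := (((hasDerivAt_id u).const_sub x).pow 2).div_const (2 * μ)
  have hlog := ((((hasDerivAt_id u).pow 2).const_add (γ ^ 2)).div_const γ).log
    (div_pos hu hγ).ne'
  refine (hquad.add hlog).congr_deriv (congrArg₂ (· + ·) ?_ ?_)
  · calc _ = 2 * (u - x) / (2 * μ) := by norm_num; ring
      _ = (u - x) / μ := mul_div_mul_left _ _ two_ne_zero
  · simp only [id, Pi.pow_apply]
    field_simp
    norm_num [mul_comm]

theorem tendsto_cauchy_prox_cost_cocompact {μ γ : ℝ} (hμ : 0 < μ) (hγ : 0 < γ) (x : ℝ) :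
    Filter.Tendsto (fun u : ℝ => (x - u) ^ 2 / (2 * μ) + Real.log ((γ ^ 2 + u ^ 2) / γ))
      (Filter.cocompact ℝ) Filter.atTop := by
  have hquad : Filter.Tendsto (fun u : ℝ => (x - u) ^ 2 / (2 * μ)) (Filter.cocompact ℝ)
      Filter.atTop := by
    have h := (Filter.tendsto_pow_atTop (two_ne_zero (α := ℕ))).comp
      (tendsto_dist_left_cocompact_atTop x)
    simpa [Function.comp_def, Real.dist_eq, sq_abs] using
      h.atTop_div_const (by positivity : 0 < 2 * μ)
  refine Filter.tendsto_atTop_mono (fun u => ?_)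
    (Filter.tendsto_atTop_add_const_right _ (Real.log γ) hquad)
  gcongr
  rw [le_div_iff₀ hγ]
  nlinarith [sq_nonneg u]

theorem cauchy_prox_unique_min (μ γ : ℝ) (hμ : 0 < μ) (hγ : 0 < γ)
    (hcond : Real.sqrt μ / 2 ≤ γ) (x : ℝ) :
    ∃! ustar : ℝ, ∀ u : ℝ,
      (x - ustar) ^ 2 / (2 * μ) + Real.log ((γ ^ 2 + ustar ^ 2) / γ) ≤
      (x - u) ^ 2 / (2 * μ) + Real.log ((γ ^ 2 + u ^ 2) / γ) := by
  have h4 : μ ≤ 4 * γ ^ 2 := by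
    nlinarith [Real.sq_sqrt hμ.le, Real.sqrt_nonneg μ]
  have hderiv := hasDerivAt_cauchy_prox_cost μ hγ x
  have hcont : Continuous fun u : ℝ =>
      (x - u) ^ 2 / (2 * μ) + Real.log ((γ ^ 2 + u ^ 2) / γ) :=
    continuous_iff_continuousAt.2 fun u => (hderiv u).continuousAt
  have hconv : StrictConvexOn ℝ Set.univ fun u : ℝ =>
      (x - u) ^ 2 / (2 * μ) + Real.log ((γ ^ 2 + u ^ 2) / γ) := by
    refine StrictMono.strictConvexOn_univ_of_deriv hcont ?_
    rw [funext fun u => (hderiv u).deriv]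
    exact strictMono_cauchy_prox_deriv hμ hγ h4 x
  obtain ⟨u, hu⟩ := hcont.exists_forall_le (tendsto_cauchy_prox_cost_cocompact hμ hγ x)
  exact ⟨u, hu, fun v hv => hconv.eq_of_isMinOn (fun w _ => hv w) (fun w _ => hu w)
    (Set.mem_univ v) (Set.mem_univ u)⟩
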